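/- arXiv:1108.1737 — 2 statements merged into one kernel-verified Lean document; each statement's English description precedes it below -/
import Mathlib

section
/- Let x ∈ B_A, t a positive integer, and q ∈ {1, …, d} with x_q = tα. Then there exists a sequence λ ∈ Λ_x (a sequence with *-property of x of length deg x) such that (t−1)α < x(λ,1)_q < tα. -/
/-- `e_i := α · (i-th standard basis vector)`, viewed in `ℤ^d`. -/
def stdGen (d α : ℕ) (i : Fin d) : Fin d → ℤ := fun j => if j = i then (α : ℤ) else 0

/-- The homogeneous simplicial affine semigroup `B ⊆ ℕ^d ⊆ ℤ^d` generated by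
`e_1, …, e_d, a_1, …, a_c`. -/
def semB (d c α : ℕ) (a : Fin c → Fin d → ℤ) : AddSubmonoid (Fin d → ℤ) :=
  AddSubmonoid.closure (Set.range (stdGen d α) ∪ Set.range a)

/-- The submonoid `A` generated by `e_1, …, e_d`. -/
def semA (d α : ℕ) : AddSubmonoid (Fin d → ℤ) :=
  AddSubmonoid.closure (Set.range (stdGen d α))

/-- `B_A = {x ∈ B : x - a ∉ B for all a ∈ A \ {0}}`. -/
def semBA (d c α : ℕ) (a : Fin c → Fin d → ℤ) : Set (Fin d → ℤ) :=
  {x | x ∈ semB d c α a ∧ ∀ y ∈ semA d α, y ≠ 0 → x - y ∉ semB d c α a}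

/-- A list `l = (b_1, …, b_n)` is a sequence with `*`-property of `x`: every entry is one of
the generators `e_1, …, e_d, a_1, …, a_c`, and all partial differences
`x(λ,i) = x - (b_1 + ⋯ + b_i)` lie in `B`. -/
def starSeq (d c α : ℕ) (a : Fin c → Fin d → ℤ) (x : Fin d → ℤ)
    (l : List (Fin d → ℤ)) : Prop :=
  (∀ v ∈ l, (∃ i, v = stdGen d α i) ∨ (∃ i, v = a i)) ∧
    ∀ i ≤ l.length, x - (l.take i).sum ∈ semB d c α a


theorem sum_stdGen (d α : ℕ) (i : Fin d) : ∑ j, stdGen d α i j = (α : ℤ) := by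
  simp [stdGen]

theorem stdGen_ne_zero {d α : ℕ} (hα : 0 < α) (i : Fin d) : stdGen d α i ≠ 0 := by
  intro h
  have := congrFun h i
  simp [stdGen] at this
  omega

/-- A nonnegative vector of coordinate sum `α` whose `q`-th coordinate is at least `α`
is the `q`-th standard generator. -/
theorem eq_stdGen_of_le {d α : ℕ} {v : Fin d → ℤ} (hv : ∀ j, 0 ≤ v j)
    (hs : ∑ j, v j = (α : ℤ)) {q : Fin d} (hq : (α : ℤ) ≤ v q) : v = stdGen d α q := by
  have hsplit := Finset.add_sum_erase Finset.univ v (Finset.mem_univ q)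
  have hnonneg : 0 ≤ ∑ j ∈ Finset.univ.erase q, v j := Finset.sum_nonneg fun j _ => hv j
  have hzero : ∑ j ∈ Finset.univ.erase q, v j = 0 := by linarith
  funext j
  by_cases hj : j = q
  · subst hj
    simp only [stdGen, if_true]
    linarith
  · simpa [stdGen, hj] using
      (Finset.sum_eq_zero_iff_of_nonneg fun j _ => hv j).1 hzero j (by simp [hj])

theorem sum_apply_eq_zero {d : ℕ} {l : List (Fin d → ℤ)} {q : Fin d}
    (h : ∀ v ∈ l, v q = 0) : l.sum q = 0 := by
  induction l with
  | nil => simp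
  | cons b l ih => simp_all

theorem length_mul_eq_sum {d : ℕ} {α : ℤ} {l : List (Fin d → ℤ)}
    (h : ∀ v ∈ l, ∑ j, v j = α) : (l.length : ℤ) * α = ∑ j, l.sum j := by
  induction l with
  | nil => simp
  | cons b l ih =>
    simp only [List.mem_cons, forall_eq_or_imp] at h
    simp only [List.length_cons, List.sum_cons, Pi.add_apply, Finset.sum_add_distrib, ← ih h.2,
      h.1]
    push_cast
    ring

theorem starSeq_of_sum_eq {d c α : ℕ} {a : Fin c → Fin d → ℤ} {x : Fin d → ℤ}
    {l : List (Fin d → ℤ)} (hl : ∀ v ∈ l, (∃ i, v = stdGen d α i) ∨ (∃ i, v = a i))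
    (hx : l.sum = x) : starSeq d c α a x l := by
  refine ⟨hl, fun i _ => ?_⟩
  rw [← hx, ← List.sum_take_add_sum_drop l i, add_sub_cancel_left]
  refine AddSubmonoid.list_sum_mem _ fun v hv => AddSubmonoid.subset_closure ?_
  rcases hl v (List.mem_of_mem_drop hv) with ⟨j, rfl⟩ | ⟨j, rfl⟩
  · exact Or.inl ⟨j, rfl⟩
  · exact Or.inr ⟨j, rfl⟩

theorem exists_starSeq_first_step (d c α : ℕ) (hd : 0 < d) (hc : 0 < c) (hα : 0 < α)
    (a : Fin c → Fin d → ℤ) (ha : ∀ i, (∀ j, 0 ≤ a i j) ∧ ∑ j, a i j = (α : ℤ))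
    (x : Fin d → ℤ) (hx : x ∈ semBA d c α a) (t : ℤ) (ht : 0 < t) (q : Fin d)
    (hq : x q = t * (α : ℤ)) :
    ∃ l : List (Fin d → ℤ), starSeq d c α a x l ∧ (l.length : ℤ) * (α : ℤ) = ∑ j, x j ∧
      (t - 1) * (α : ℤ) < (x - (l.take 1).sum) q ∧ (x - (l.take 1).sum) q < t * (α : ℤ) := by
  obtain ⟨l, hl, hsum⟩ := AddSubmonoid.exists_list_of_mem_closure hx.1
  have hgen : ∀ v ∈ l, (∃ i, v = stdGen d α i) ∨ (∃ i, v = a i) := fun v hv =>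
    (hl v hv).imp (fun ⟨i, h⟩ => ⟨i, h.symm⟩) (fun ⟨i, h⟩ => ⟨i, h.symm⟩)
  have hcons : ∀ b ∈ l, starSeq d c α a x (b :: l.erase b) := fun b hb =>
    starSeq_of_sum_eq (fun v hv => hgen v ((List.perm_cons_erase hb).mem_iff.2 hv))
      ((List.perm_cons_erase hb).sum_eq.symm.trans hsum)
  have hnot : ∀ i, stdGen d α i ∉ l := by
    intro i hi
    refine hx.2 _ (AddSubmonoid.subset_closure ⟨i, rfl⟩) (stdGen_ne_zero hα i) ?_
    simpa using (hcons _ hi).2 1 (by simp)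
  have hmem : ∀ v ∈ l, (∀ j, 0 ≤ v j) ∧ ∑ j, v j = (α : ℤ) := by
    intro v hv
    rcases hgen v hv with ⟨i, rfl⟩ | ⟨i, rfl⟩
    · exact absurd hv (hnot i)
    · exact ha i
  have hα' : (0 : ℤ) < α := by exact_mod_cast hα
  obtain ⟨b, hb, hbq⟩ : ∃ b ∈ l, b q ≠ 0 := by
    by_contra! h
    have hxq := sum_apply_eq_zero h
    rw [hsum, hq] at hxq
    exact (mul_pos ht hα').ne' hxq
  have hpos : 0 < b q := lt_of_le_of_ne ((hmem b hb).1 q) hbq.symm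
  have hlt : b q < α := by
    by_contra! h
    exact hnot q (eq_stdGen_of_le (hmem b hb).1 (hmem b hb).2 h ▸ hb)
  refine ⟨b :: l.erase b, hcons b hb, ?_, ?_, ?_⟩
  · rw [← (List.perm_cons_erase hb).length_eq, length_mul_eq_sum fun v hv => (hmem v hv).2, hsum]
  · simp only [List.take_succ_cons, List.take_zero, List.sum_singleton, Pi.sub_apply, hq]
    linarith
  · simp only [List.take_succ_cons, List.take_zero, List.sum_singleton, Pi.sub_apply, hq]
    linarith
end

section
/- Let Γ be a ∼-equivalence class of B_A with Γ ⊆ box(B), let h ∈ ℕ^d be the coordinatewise minimum of Γ (h_i = min{m_i : m ∈ Γ}), and let S := {q ∈ {1, …, d} : x_q > h_q for some x ∈ Γ}. Then #S ≤ d − 1 − deg h, where deg h := (h_1 + … + h_d)/α (a nonnegative integer). (Here #S equals var(I_t), the number of variables occurring in the squarefree monomial ideal I_t associated to Γ in the Hoa–Stückrad decomposition, and deg h is the shift of I_t.) -/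
/-- `box(B) = {x ∈ B : x_i ≤ α for all i}`. -/
def boxB (d c α : ℕ) (a : Fin c → Fin d → ℤ) : Set (Fin d → ℤ) :=
  {x | x ∈ semB d c α a ∧ ∀ i, x i ≤ (α : ℤ)}

/-- `Γ` is an equivalence class of the relation `x ∼ y ⟺ x - y ∈ αℤ^d` restricted to `B_A`. -/
def IsClassOfBA (d c α : ℕ) (a : Fin c → Fin d → ℤ) (Γ : Set (Fin d → ℤ)) : Prop :=
  ∃ w ∈ semBA d c α a, Γ = {y ∈ semBA d c α a | ∀ j : Fin d, (α : ℤ) ∣ (y j - w j)}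

theorem semB_nonneg {d c α : ℕ} {a : Fin c → Fin d → ℤ} (ha : ∀ i j, 0 ≤ a i j)
    {x : Fin d → ℤ} (hx : x ∈ semB d c α a) (j : Fin d) : 0 ≤ x j := by
  induction hx using AddSubmonoid.closure_induction with
  | mem y hy =>
    rcases hy with ⟨i, rfl⟩ | ⟨i, rfl⟩
    · unfold stdGen
      split_ifs <;> simp
    · exact ha i j
  | zero => simp
  | add y z _ _ hy hz => exact add_nonneg hy hz

theorem mem_semA_of_nonneg_of_dvd {d α : ℕ} {x : Fin d → ℤ} (hx : ∀ j, 0 ≤ x j)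
    (hdvd : ∀ j, (α : ℤ) ∣ x j) : x ∈ semA d α := by
  have key : x = ∑ i, (x i / α).toNat • stdGen d α i := by
    ext j
    have hq : 0 ≤ x j / (α : ℤ) := Int.ediv_nonneg (hx j) (by positivity)
    simp [stdGen, Finset.sum_apply, hq, Int.ediv_mul_cancel (hdvd j)]
  rw [key]
  exact sum_mem fun i _ => nsmul_mem (AddSubmonoid.subset_closure (Set.mem_range_self i)) _

theorem eq_zero_of_mem_semBA_of_dvd {d c α : ℕ} {a : Fin c → Fin d → ℤ}
    (ha : ∀ i j, 0 ≤ a i j) {x : Fin d → ℤ} (hx : x ∈ semBA d c α a)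
    (hdvd : ∀ j, (α : ℤ) ∣ x j) : x = 0 := by
  by_contra hne
  refine hx.2 x (mem_semA_of_nonneg_of_dvd (semB_nonneg ha hx.1) hdvd) hne ?_
  rw [sub_self]
  exact zero_mem _

theorem class_support_card_le (d c α : ℕ) (hd : 0 < d) (hc : 0 < c) (hα : 0 < α)
    (a : Fin c → Fin d → ℤ) (ha : ∀ i, (∀ j, 0 ≤ a i j) ∧ ∑ j, a i j = (α : ℤ))
    (Γ : Set (Fin d → ℤ)) (hΓ : IsClassOfBA d c α a Γ) (hbox : Γ ⊆ boxB d c α a)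
    (h : Fin d → ℤ) (hmin : ∀ i : Fin d, IsLeast {v : ℤ | ∃ x ∈ Γ, x i = v} (h i))
    (r : ℤ) (hr : ∑ j, h j = r * (α : ℤ)) :
    ((Set.ncard {q : Fin d | ∃ x ∈ Γ, h q < x q} : ℤ)) ≤ (d : ℤ) - 1 - r := by
  classical
  have ha' : ∀ i j, 0 ≤ a i j := fun i => (ha i).1
  have hα' : (0 : ℤ) < α := by exact_mod_cast hα
  have hBA : ∀ x ∈ Γ, x ∈ semBA d c α a := by
    obtain ⟨w, -, rfl⟩ := hΓ
    exact fun x hx => hx.1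
  have hcongr : ∀ x ∈ Γ, ∀ y ∈ Γ, ∀ j, (α : ℤ) ∣ x j - y j := by
    obtain ⟨w, -, rfl⟩ := hΓ
    intro x hx y hy j
    simpa using dvd_sub (hx.2 j) (hy.2 j)
  have hdiff : ∀ x ∈ Γ, ∀ j, (α : ℤ) ∣ x j - h j := by
    intro x hx j
    obtain ⟨y, hy, hyj⟩ := (hmin j).1
    exact hyj ▸ hcongr x hx y hy j
  by_cases hall : ∀ j, (α : ℤ) ∣ h j
  · have hzero : ∀ x ∈ Γ, x = 0 := fun x hx =>
      eq_zero_of_mem_semBA_of_dvd ha' (hBA x hx) fun j =>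
        (dvd_sub_left (hall j)).1 (hdiff x hx j)
    have hh : ∀ j, h j = 0 := by
      intro j
      obtain ⟨y, hy, hyj⟩ := (hmin j).1
      rw [← hyj, hzero y hy, Pi.zero_apply]
    have hS : {q : Fin d | ∃ x ∈ Γ, h q < x q} = ∅ := by
      refine Set.eq_empty_of_forall_notMem ?_
      rintro q ⟨x, hx, hlt⟩
      simp [hzero x hx, hh q] at hlt
    have hr0 : r = 0 := by
      simpa [hh, hα.ne'] using hr
    rw [hS, Set.ncard_empty, hr0]
    omega
  · push Not at hall
    obtain ⟨i, hi⟩ := hall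
    set S : Set (Fin d) := {q | ∃ x ∈ Γ, h q < x q} with hS
    have hle : ∀ j, (if j ∈ S then (α : ℤ) else 0) + h j ≤ α := by
      intro j
      split_ifs with hj
      · obtain ⟨x, hx, hlt⟩ := hj
        have := Int.le_of_dvd (sub_pos.2 hlt) (hdiff x hx j)
        have := (hbox hx).2 j
        linarith
      · obtain ⟨y, hy, hyj⟩ := (hmin j).1
        rw [zero_add, ← hyj]
        exact (hbox hy).2 j
    have hlt : (if i ∈ S then (α : ℤ) else 0) + h i < α := by
      refine lt_of_le_of_ne (hle i) fun heq => hi ?_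
      split_ifs at heq with hj
      · exact ⟨0, by linarith⟩
      · exact ⟨1, by linarith⟩
    have hsum := Finset.sum_lt_sum (fun j (_ : j ∈ Finset.univ) => hle j)
      ⟨i, Finset.mem_univ i, hlt⟩
    have hcard : (∑ j, if j ∈ S then (α : ℤ) else 0) = (S.ncard : ℤ) * α := by
      rw [Set.ncard_eq_toFinset_card', ← Finset.sum_filter, Finset.sum_const, nsmul_eq_mul]
      congr 3
      ext j
      simp
    rw [Finset.sum_add_distrib, hcard, hr, Finset.sum_const, Finset.card_univ, Fintype.card_fin,
      nsmul_eq_mul, ← add_mul] at hsum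
    have := lt_of_mul_lt_mul_right hsum hα'.le
    omega
end
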